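/- Key compose lemma: with the suppressed casts made explicit, compose (cast (compose (cast α) β)) γ = cast (compose (cast (compose (cast α) γ)) β), where α : arr c (t → t'), β, γ are curried functions of appropriate types, and all casts are along provable equalities of arr-types arising from list splice equalities. The proof proceeds by induction on the relevant lists. -/

import Mathlib

def splice {T : Type*} (cl bl : List T) (k : ℕ) : List T :=
  cl.take k ++ bl ++ cl.drop (k+1)

def arr : List Type → Type → Type
  | [], d => d
  | t :: ts, d => t → arr ts d

def mapArr {t t' : Type} (f : t → t') : ∀ {bl : List Type}, arr bl t → arr bl t'
  | [], g => f g
  | _ :: _, g => fun y => mapArr f (g y)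

def compose : ∀ {cl bl : List Type} {t t' : Type},
    arr cl (t → t') → arr bl t → arr cl (arr bl t')
  | [], _, _, _, f, g => mapArr f g
  | _ :: _, _, _, _, f, g => fun x => compose (f x) g

theorem list_split {T : Type*} (cl : List T) (i : ℕ) (h : i < cl.length) :
    cl.take i ++ cl[i] :: cl.drop (i+1) = cl := by
  conv_rhs => rw [← List.take_append_drop i cl, List.drop_eq_getElem_cons h]

theorem arr_append (l1 l2 : List Type) (d : Type) :
    arr (l1 ++ l2) d = arr l1 (arr l2 d) := by
  induction l1 with
  | nil => rfl
  | cons t ts ih => exact congrArg (fun X => t → X) ih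

theorem arr_eq_split (cl : List Type) (d : Type) (i : ℕ) (hi : i < cl.length) :
    arr cl d = arr (cl.take i) (cl[i] → arr (cl.drop (i+1)) d) := by
  conv_lhs => rw [← list_split cl i hi]
  rw [arr_append]
  rfl

theorem arr_splice_eq (cl bl : List Type) (d : Type) (i : ℕ) :
    arr (splice cl bl i) d = arr (cl.take i) (arr bl (arr (cl.drop (i+1)) d)) := by
  simp [splice, arr_append]

def ocomp {cl bl : List Type} {d ci : Type} (i : ℕ) (hi : i < cl.length)
    (hci : cl[i] = ci) (α : arr cl d) (β : arr bl ci) : arr (splice cl bl i) d :=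
  cast (arr_splice_eq cl bl d i).symm
    (compose (cast (by rw [arr_eq_split cl d i hi, hci]) α) β)

theorem heq_apply_of_heq {t A B : Type} (e : A = B) {f : t → A} {g : t → B} (h : f ≍ g) (x : t) :
    f x ≍ g x := by
  subst e; cases h; rfl

theorem heq_funext {t A B : Type} (e : A = B) {f : t → A} {g : t → B} (h : ∀ x, f x ≍ g x) :
    f ≍ g := by
  subst e; exact heq_of_eq (funext fun x => eq_of_heq (h x))

theorem compose_append_heq {l₁ l₂ bl : List Type} {t t' : Type} (g : arr bl t)
    (f : arr l₁ (arr l₂ (t → t'))) (f' : arr (l₁ ++ l₂) (t → t')) (h : f' ≍ f) :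
    compose f' g ≍ mapArr (fun x : arr l₂ (t → t') => compose x g) f := by
  induction l₁ with
  | nil => cases h; rfl
  | cons s l ih =>
    exact heq_funext (arr_append l l₂ _)
      fun x => ih (f x) (f' x) (heq_apply_of_heq (arr_append l l₂ _) h x)

theorem mapArr_append_heq {l₁ l₂ : List Type} {t t' : Type} (k : t → t')
    (f : arr l₁ (arr l₂ t)) (f' : arr (l₁ ++ l₂) t) (h : f' ≍ f) :
    mapArr k f' ≍ mapArr (mapArr k (bl := l₂)) f := by
  induction l₁ with
  | nil => cases h; rfl
  | cons s l ih =>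
    exact heq_funext (arr_append l l₂ _)
      fun x => ih (f x) (f' x) (heq_apply_of_heq (arr_append l l₂ _) h x)

theorem mapArr_mapArr {bl : List Type} {t t' t'' : Type} (k : t' → t'') (h : t → t')
    (g : arr bl t) : mapArr k (mapArr h g) = mapArr (fun x => k (h x)) g := by
  induction bl with
  | nil => rfl
  | cons s l ih => exact funext fun x => ih (g x)

theorem compose_mapArr {cl bl : List Type} {t t' t'' : Type} (k : t' → t'')
    (f : arr cl (t → t')) (g : arr bl t) :
    compose (mapArr (fun (u : t → t') x => k (u x)) f) g =
      mapArr (mapArr k (bl := bl)) (compose f g) := by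
  induction cl with
  | nil => exact (mapArr_mapArr k f g).symm
  | cons s l ih => exact funext fun x => ih (f x)

theorem compose_compose_cast {al bl c l₁ l₂ P Q : List Type} {a b d X Y D D' : Type}
    (hX : X = arr l₂ (b → D)) (hY : Y = arr l₂ (arr bl D))
    (hP : P = l₁ ++ (al ++ l₂)) (hD : D' = D)
    {L : List Type} (hL : L = l₁) (hQ : Q = l₁ ++ a :: l₂)
    (e1 : arr c d = arr l₁ (a → X))
    (e2 : arr l₁ (arr al X) = arr P (b → D'))
    (e3 : arr c d = arr Q (b → D))
    (e4 : arr Q (arr bl D) = arr L (a → Y))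
    (e5 : arr L (arr al Y) = arr P (arr bl D'))
    (α : arr c d) (β : arr al a) (γ : arr bl b) :
    compose (cast e2 (compose (cast e1 α) β)) γ =
      cast e5 (compose (cast e4 (compose (cast e3 α) γ)) β) := by
  subst hX hY hP hD hL hQ
  apply eq_of_heq
  refine HEq.trans ?_ (cast_heq _ _).symm
  have hr : cast e4 (compose (cast e3 α) γ) =
      mapArr (fun (u : a → arr l₂ (b → D')) x => compose (u x) γ) (cast e1 α) :=
    eq_of_heq ((cast_heq _ _).trans (compose_append_heq (l₂ := a :: l₂) γ (cast e1 α) _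
      ((cast_heq _ _).trans (cast_heq _ _).symm)))
  rw [hr, compose_mapArr (fun x : arr l₂ (b → D') => compose x γ)]
  generalize compose (cast e1 α) β = δ
  have e : arr L (arr al (arr l₂ (b → D'))) = arr (L ++ al) (arr l₂ (b → D')) :=
    (arr_append _ _ _).symm
  refine HEq.trans ?_ (mapArr_append_heq _ δ (cast e δ) (cast_heq _ _))
  have key : ∀ (M : List Type) (hM : M = (L ++ al) ++ l₂) (f' : arr M (b → D')), f' ≍ δ →
      compose f' γ ≍
        mapArr (fun x : arr l₂ (b → D') => compose x γ) (cast e δ) := by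
    rintro M rfl f' h
    exact compose_append_heq γ _ f' (h.trans (cast_heq _ _).symm)
  exact key _ (List.append_assoc _ _ _).symm _ (cast_heq _ _)

theorem compose_key_lemma {cl al bl : List Type} {d : Type} {i j ℓ : ℕ}
    (hi : i < cl.length) (hj : j < cl.length) (hij : i < j)
    (hl : al.length = ℓ) (hl1 : 1 ≤ ℓ)
    (e1 : arr cl d = arr (cl.take i) (cl[i] → arr (cl.drop (i+1)) d))
    (e2 : arr (cl.take i) (arr al (arr (cl.drop (i+1)) d)) =
          arr ((splice cl al i).take (ℓ - 1 + j))
            (cl[j] → arr ((splice cl al i).drop (ℓ - 1 + j + 1)) d))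
    (e3 : arr cl d = arr (cl.take j) (cl[j] → arr (cl.drop (j+1)) d))
    (e4 : arr (cl.take j) (arr bl (arr (cl.drop (j+1)) d)) =
          arr ((splice cl bl j).take i)
            (cl[i] → arr ((splice cl bl j).drop (i+1)) d))
    (e5 : arr ((splice cl bl j).take i) (arr al (arr ((splice cl bl j).drop (i+1)) d)) =
          arr ((splice cl al i).take (ℓ - 1 + j))
            (arr bl (arr ((splice cl al i).drop (ℓ - 1 + j + 1)) d)))
    (α : arr cl d) (β : arr al cl[i]) (γ : arr bl cl[j]) :
    compose (cast e2 (compose (cast e1 α) β)) γ =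
      cast e5 (compose (cast e4 (compose (cast e3 α) γ)) β) := by
  have hdrop : cl.drop (i + 1) =
      (cl.drop (i + 1)).take (j - (i + 1)) ++ cl[j] :: cl.drop (j + 1) := by
    conv_lhs => rw [← List.take_append_drop (j - (i + 1)) (cl.drop (i + 1))]
    rw [List.drop_drop, show i + 1 + (j - (i + 1)) = j by omega, List.drop_eq_getElem_cons hj]
  have htake : cl.take j = cl.take i ++ cl[i] :: (cl.drop (i + 1)).take (j - (i + 1)) := by
    conv_lhs => rw [← list_split cl i hi]
    rw [List.take_append, List.take_of_length_le (by simp; omega),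
      show j - (cl.take i).length = (j - (i + 1)) + 1 by simp; omega, List.take_succ_cons]
  have hlen : ((cl.drop (i + 1)).take (j - (i + 1))).length = j - (i + 1) := by
    simp; omega
  have hlen' : (cl.take i).length = i := by simp; omega
  generalize hl₂ : (cl.drop (i + 1)).take (j - (i + 1)) = l₂ at hdrop htake hlen
  have hA : splice cl al i = (cl.take i ++ (al ++ l₂)) ++ cl[j] :: cl.drop (j + 1) := by
    unfold splice
    conv_lhs => rw [hdrop]
    simp
  have hB : splice cl bl j = cl.take i ++ cl[i] :: (l₂ ++ (bl ++ cl.drop (j + 1))) := by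
    unfold splice
    conv_lhs => rw [htake]
    simp
  have hlenA : (cl.take i ++ (al ++ l₂)).length = ℓ - 1 + j := by
    simp only [List.length_append, hlen, hlen', hl]; omega
  refine compose_compose_cast (l₂ := l₂) ?_ ?_ ?_ ?_ ?_ htake e1 e2 e3 e4 e5 α β γ
  · rw [hdrop, arr_append]; rfl
  · rw [hB, ← List.drop_drop, List.drop_left' hlen', List.drop_succ_cons, List.drop_zero,
      arr_append, arr_append]
  · rw [hA, List.take_left' hlenA]
  · rw [hA, ← List.drop_drop, List.drop_left' hlenA, List.drop_succ_cons, List.drop_zero]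
  · rw [hB, List.take_left' hlen']
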